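/- arXiv:2106.10704 — 3 statements merged into one kernel-verified Lean document; each statement's English description precedes it below -/
import Mathlib

section
/- Let g : ℝ^d → ℝ^m be twice continuously differentiable with Jacobian G(q) = ∇_qᵀ g(q) of full row rank m on an open set U, let Π(q) = I_d − G⁺(q) G(q) with G⁺ = Gᵀ(G Gᵀ)⁻¹, and let H(q)_i = Σ_{j,k=1}^d Π_{jk}(q) ∂_j Π_{ik}(q) be the mean curvature vector. Then for every 1 ≤ i ≤ m and every q ∈ U: Σ_{j,k=1}^d Π_{jk}(q) ∂²_{jk} g_i(q) = −(G(q) H(q))_i; that is, the Frobenius contraction Π : ∇²g_i of the projection with the Hessian of each constraint component equals minus the i-th component of G H. -/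
open Matrix

theorem Matrix.isUnit_of_rank_eq {n : ℕ} {A : Matrix (Fin n) (Fin n) ℝ} (h : A.rank = n) :
    IsUnit A := by
  rw [← Matrix.mulVec_surjective_iff_isUnit]
  have htop : LinearMap.range A.mulVecLin = ⊤ :=
    Submodule.eq_top_of_finrank_eq (by simpa [Matrix.rank] using h)
  exact LinearMap.range_eq_top.1 htop

section MatrixCalculus

variable {E : Type*} [NormedAddCommGroup E] [NormedSpace ℝ E]
  {l n p : Type*} [Fintype n]

theorem differentiableAt_matrix_mul_entry {A : E → Matrix l n ℝ} {B : E → Matrix n p ℝ} {x : E}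
    (hA : ∀ i j, DifferentiableAt ℝ (fun y => A y i j) x)
    (hB : ∀ i j, DifferentiableAt ℝ (fun y => B y i j) x) (i : l) (j : p) :
    DifferentiableAt ℝ (fun y => (A y * B y) i j) x := by
  simp only [Matrix.mul_apply]
  exact DifferentiableAt.fun_sum fun k _ => (hA i k).mul (hB k j)

variable [DecidableEq n]

theorem differentiableAt_matrix_det {A : E → Matrix n n ℝ} {x : E}
    (hA : ∀ i j, DifferentiableAt ℝ (fun y => A y i j) x) :
    DifferentiableAt ℝ (fun y => (A y).det) x := by
  simp only [Matrix.det_apply']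
  exact DifferentiableAt.fun_sum fun σ _ =>
    (HasFDerivAt.finsetProd fun i _ =>
      (hA (σ i) i).hasFDerivAt).differentiableAt.const_mul _

theorem differentiableAt_matrix_inv_entry {A : E → Matrix n n ℝ} {x : E}
    (hA : ∀ i j, DifferentiableAt ℝ (fun y => A y i j) x) (hx : (A x).det ≠ 0) (i j : n) :
    DifferentiableAt ℝ (fun y => (A y)⁻¹ i j) x := by
  simp only [Matrix.inv_def, Matrix.smul_apply, Ring.inverse_eq_inv', smul_eq_mul,
    Matrix.adjugate_apply]
  refine ((differentiableAt_matrix_det hA).inv hx).mul (differentiableAt_matrix_det fun a b => ?_)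
  by_cases hab : a = j
  · subst hab
    simp
  · simpa [Matrix.updateRow_ne hab] using hA a b

end MatrixCalculus

section RowProjection

variable {m n : Type*} [Fintype m] [DecidableEq m] [Fintype n] [DecidableEq n]

theorem mul_kernelProjection_eq_zero {A : Matrix m n ℝ} (h : IsUnit (A * Aᵀ)) :
    A * (1 - Aᵀ * (A * Aᵀ)⁻¹ * A) = 0 := by
  rw [Matrix.mul_sub, Matrix.mul_one, ← Matrix.mul_assoc, ← Matrix.mul_assoc,
    Matrix.mul_nonsing_inv _ ((Matrix.isUnit_iff_isUnit_det _).1 h), Matrix.one_mul, sub_self]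

theorem kernelProjection_isSymm (A : Matrix m n ℝ) :
    (1 - Aᵀ * (A * Aᵀ)⁻¹ * A)ᵀ = 1 - Aᵀ * (A * Aᵀ)⁻¹ * A := by
  simp [Matrix.transpose_nonsing_inv, Matrix.mul_assoc]

theorem kernelProjection_mul_self {A : Matrix m n ℝ} (h : IsUnit (A * Aᵀ)) :
    (1 - Aᵀ * (A * Aᵀ)⁻¹ * A) * (1 - Aᵀ * (A * Aᵀ)⁻¹ * A) = 1 - Aᵀ * (A * Aᵀ)⁻¹ * A := by
  nth_rw 1 [Matrix.sub_mul]
  rw [Matrix.one_mul, Matrix.mul_assoc _ A, mul_kernelProjection_eq_zero h, Matrix.mul_zero,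
    sub_zero]

end RowProjection

/-- For a `C²` constraint map `g : ℝ^d → ℝ^m` whose Jacobian `G(q)` has full
row rank on an open set `U`, with `Π(q) = I − G⁺(q)G(q)` and mean curvature vector
`H(q)_i = Σ_{j,k} Π_{jk}(q) ∂_j Π_{ik}(q)`, for each constraint component `g_i` the
Frobenius contraction of `Π(q)` with the Hessian of `g_i` satisfies
`Σ_{j,k} Π_{jk}(q) ∂²_{jk} g_i(q) = −(G(q) H(q))_i` on `U`. -/
theorem stmt_3 {d m : ℕ} (g : (Fin d → ℝ) → (Fin m → ℝ))
    (hg : ContDiff ℝ 2 g)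
    (U : Set (Fin d → ℝ)) (hU : IsOpen U)
    (G : (Fin d → ℝ) → Matrix (Fin m) (Fin d) ℝ)
    (hG : ∀ q i j, G q i j = fderiv ℝ g q (Pi.single j 1) i)
    (hrank : ∀ q ∈ U, (G q).rank = m)
    (Pr : (Fin d → ℝ) → Matrix (Fin d) (Fin d) ℝ)
    (hPr : ∀ q, Pr q = 1 - (G q)ᵀ * (G q * (G q)ᵀ)⁻¹ * G q)
    (H : (Fin d → ℝ) → (Fin d → ℝ))
    (hH : ∀ q i, H q i =
      ∑ j, ∑ k, Pr q j k * fderiv ℝ (fun x => Pr x i k) q (Pi.single j 1)) :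
    ∀ q ∈ U, ∀ i : Fin m,
      ∑ j, ∑ k, Pr q j k *
        fderiv ℝ (fun x => fderiv ℝ (fun y => g y i) x (Pi.single k 1)) q (Pi.single j 1)
      = -((G q).mulVec (H q) i) := by
  intro q hq i
  have hunit : ∀ x ∈ U, IsUnit (G x * (G x)ᵀ) := fun x hx =>
    Matrix.isUnit_of_rank_eq ((Matrix.rank_self_mul_transpose _).trans (hrank x hx))
  have hdet : (G q * (G q)ᵀ).det ≠ 0 :=
    ((Matrix.isUnit_iff_isUnit_det _).1 (hunit q hq)).ne_zero
  have hgd : Differentiable ℝ g := hg.differentiable (by norm_num)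
  have hfd : Differentiable ℝ (fderiv ℝ g) :=
    (hg.fderiv_right (m := 1) (by norm_num)).differentiable (by norm_num)
  have hGd : ∀ a b, DifferentiableAt ℝ (fun x => G x a b) q := by
    intro a b
    simp only [hG]
    exact differentiableAt_pi.1 ((hfd q).clm_apply (differentiableAt_const _)) a
  have hGtd : ∀ a b, DifferentiableAt ℝ (fun x => (G x)ᵀ a b) q := fun a b => hGd b a
  have hPd : ∀ a b, DifferentiableAt ℝ (fun x => Pr x a b) q := by
    intro a b
    simp only [hPr, Matrix.sub_apply]
    exact (differentiableAt_const _).sub (differentiableAt_matrix_mul_entry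
      (differentiableAt_matrix_mul_entry hGtd (differentiableAt_matrix_inv_entry
        (differentiableAt_matrix_mul_entry hGd hGtd) hdet)) hGd a b)
  have hgrad : ∀ k, (fun x => fderiv ℝ (fun y => g y i) x (Pi.single k 1)) =
      fun x => G x i k := by
    intro k
    funext x
    rw [hG, fderiv_apply (hgd x) i]
    rfl
  simp only [hgrad]
  have hleibniz : ∀ j k, ∑ l, (fderiv ℝ (fun x => G x i l) q (Pi.single j 1) * Pr q l k +
      G q i l * fderiv ℝ (fun x => Pr x l k) q (Pi.single j 1)) = 0 := by
    intro j k
    have hzero : (fun x => ∑ l, G x i l * Pr x l k) =ᶠ[nhds q] fun _ => 0 := by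
      filter_upwards [hU.mem_nhds hq] with x hx
      have := congrFun (congrFun (mul_kernelProjection_eq_zero (hunit x hx)) i) k
      rwa [← hPr, Matrix.mul_apply] at this
    have hder := HasFDerivAt.fun_sum (u := Finset.univ) fun l _ =>
      (hGd i l).hasFDerivAt.mul (hPd l k).hasFDerivAt
    have := congrArg (fun L => L (Pi.single j 1)) (hder.fderiv.symm.trans hzero.fderiv_eq)
    simp only [fderiv_fun_const, Pi.zero_apply, _root_.sum_apply,
      _root_.add_apply, _root_.smul_apply, smul_eq_mul,
      _root_.zero_apply] at this
    rw [← this]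
    exact Finset.sum_congr rfl fun l _ => by ring
  have hsymm : ∀ a b, Pr q a b = Pr q b a := by
    intro a b
    have := congrFun (congrFun (kernelProjection_isSymm (G q)) b) a
    rwa [← hPr] at this
  have hidem : ∀ j l, ∑ k, Pr q j k * Pr q l k = Pr q j l := by
    intro j l
    have := congrFun (congrFun (kernelProjection_mul_self (hunit q hq)) j) l
    rw [← hPr, Matrix.mul_apply] at this
    rw [← this]
    exact Finset.sum_congr rfl fun k _ => by rw [hsymm l k]
  rw [eq_neg_iff_add_eq_zero]
  calc _ = ∑ j, ∑ k, Pr q j k *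
        ∑ l, (fderiv ℝ (fun x => G x i l) q (Pi.single j 1) * Pr q l k +
          G q i l * fderiv ℝ (fun x => Pr x l k) q (Pi.single j 1)) := by
        simp only [Finset.sum_add_distrib, mul_add]
        congr 1
        · refine Finset.sum_congr rfl fun j _ => ?_
          simp only [Finset.mul_sum]
          rw [Finset.sum_comm]
          refine Finset.sum_congr rfl fun l _ => ?_
          rw [← hidem j l, Finset.sum_mul]
          exact Finset.sum_congr rfl fun k _ => by ring
        · simp only [Matrix.mulVec, dotProduct, hH, Finset.mul_sum]
          rw [Finset.sum_comm]
          refine Finset.sum_congr rfl fun j _ => ?_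
          rw [Finset.sum_comm]
          exact Finset.sum_congr rfl fun k _ => Finset.sum_congr rfl fun l _ => by ring
    _ = 0 := by simp [hleibniz]
end

section
/- Let r > 0, let w₀ = (θ₀, ξ₀) ∈ ℝ² satisfy |θ₀|² + |ξ₀|² = r², and let p₀ = (p₀^c, p₀^ξ) ∈ ℝ² satisfy θ₀ p₀^c + ξ₀ p₀^ξ = 0. Set ω = (ξ₀ p₀^c − θ₀ p₀^ξ)/r², let R_t^ω = [[cos(ωt), sin(ωt)], [−sin(ωt), cos(ωt)]], and define w_t = R_t^ω w₀ and p_t = (d/dt) w_t. Then for all t ∈ ℝ: (i) w_t' = p_t and p_t' = −ω² w_t, so (w_t, p_t) solves the system ẇ = p, ṗ = −2λ w with λ = ω²/2; (ii) the position constraint |w_t|² = r² holds; (iii) the cotangency constraint w_t · p_t = 0 holds; and (iv) the initial momentum is matched: p_0 = p₀. -/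
/-- A linear combination of `cos (ω t)` and `sin (ω t)` differentiates to `ω` times the
combination with coefficients rotated by a quarter turn. -/
theorem hasDerivAt_cos_mul_add_sin_mul (ω a b t : ℝ) :
    HasDerivAt (fun s => Real.cos (ω * s) * a + Real.sin (ω * s) * b)
      (Real.cos (ω * t) * (ω * b) + Real.sin (ω * t) * (-(ω * a))) t := by
  have h : HasDerivAt (fun s => ω * s) ω t := by
    simpa using (hasDerivAt_id t).const_mul ω
  refine ((h.cos.mul_const a).add (h.sin.mul_const b)).congr_deriv ?_
  ring

/-- With circle-constrained initial data `(θ₀, ξ₀)` on the circle of radius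
`r` and momentum `(pc₀, pξ₀)` in the cotangent space, setting
`ω = (ξ₀ pc₀ − θ₀ pξ₀)/r²` and `w_t = R_t^ω w₀`, `p_t = ẇ_t`, the curve solves
`ẇ = p`, `ṗ = −2λw` with `λ = ω²/2`, stays on the circle, satisfies the cotangency
constraint `w_t · p_t = 0` for all `t`, and matches the initial momentum. -/
theorem stmt_9 (r θ₀ ξ₀ pc₀ pξ₀ ω : ℝ) (hr : 0 < r)
    (hconstr : θ₀ ^ 2 + ξ₀ ^ 2 = r ^ 2)
    (hcot : θ₀ * pc₀ + ξ₀ * pξ₀ = 0)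
    (hω : ω = (ξ₀ * pc₀ - θ₀ * pξ₀) / r ^ 2)
    (θ ξ pθ pξ : ℝ → ℝ)
    (hθ : ∀ t, θ t = Real.cos (ω * t) * θ₀ + Real.sin (ω * t) * ξ₀)
    (hξ : ∀ t, ξ t = -Real.sin (ω * t) * θ₀ + Real.cos (ω * t) * ξ₀)
    (hpθ : ∀ t, pθ t = deriv θ t) (hpξ : ∀ t, pξ t = deriv ξ t) :
    (∀ t, HasDerivAt θ (pθ t) t ∧ HasDerivAt ξ (pξ t) t ∧
      HasDerivAt pθ (-2 * (ω ^ 2 / 2) * θ t) t ∧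
      HasDerivAt pξ (-2 * (ω ^ 2 / 2) * ξ t) t) ∧
    (∀ t, (θ t) ^ 2 + (ξ t) ^ 2 = r ^ 2) ∧
    (∀ t, θ t * pθ t + ξ t * pξ t = 0) ∧
    (pθ 0 = pc₀ ∧ pξ 0 = pξ₀) := by
  have hθ' : θ = fun s => Real.cos (ω * s) * θ₀ + Real.sin (ω * s) * ξ₀ := funext hθ
  have hξ' : ξ = fun s => Real.cos (ω * s) * ξ₀ + Real.sin (ω * s) * (-θ₀) := by
    funext s
    rw [hξ]
    ring
  have dθ := hasDerivAt_cos_mul_add_sin_mul ω θ₀ ξ₀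
  have dξ := hasDerivAt_cos_mul_add_sin_mul ω ξ₀ (-θ₀)
  rw [← hθ'] at dθ
  rw [← hξ'] at dξ
  have hpθ' := funext fun t => (hpθ t).trans (dθ t).deriv
  have hpξ' := funext fun t => (hpξ t).trans (dξ t).deriv
  refine ⟨fun t => ⟨?_, ?_, ?_, ?_⟩, fun t => ?_, fun t => ?_, ?_, ?_⟩
  · rw [hpθ t, (dθ t).deriv]
    exact dθ t
  · rw [hpξ t, (dξ t).deriv]
    exact dξ t
  · rw [hpθ']
    convert hasDerivAt_cos_mul_add_sin_mul ω (ω * ξ₀) (-(ω * θ₀)) t using 1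
    rw [hθ]
    ring
  · rw [hpξ']
    convert hasDerivAt_cos_mul_add_sin_mul ω (ω * -θ₀) (-(ω * ξ₀)) t using 1
    rw [hξ]
    ring
  · rw [hθ, hξ]
    linear_combination hconstr + (θ₀ ^ 2 + ξ₀ ^ 2) * Real.sin_sq_add_cos_sq (ω * t)
  · rw [hpθ', hpξ', hθ, hξ]
    ring
  · have hr2 : r ^ 2 ≠ 0 := by positivity
    simp only [hpθ', mul_zero, Real.cos_zero, Real.sin_zero, zero_mul, add_zero, one_mul]
    rw [hω]
    field_simp
    linear_combination pc₀ * hconstr - θ₀ * hcot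
  · have hr2 : r ^ 2 ≠ 0 := by positivity
    simp only [hpξ', mul_zero, Real.cos_zero, Real.sin_zero, zero_mul, add_zero, one_mul]
    rw [hω]
    field_simp
    linear_combination pξ₀ * hconstr - ξ₀ * hcot
end

section
/- Let V : ℝ^n → ℝ be differentiable, let h > 0 and γ ≥ 0, and set μ = e^{−γ h} and δt = h². Consider the OBA discretization of underdamped Langevin dynamics at temperature τ = 0: p_{n+1} = e^{−γ h} p_n − h ∇V(q_n), q_{n+1} = q_n + h p_{n+1}; and the PyTorch form of SGD with momentum μ and stepsize δt: v_{n+1} = μ v_n + ∇V(q̃_n), q̃_{n+1} = q̃_n − δt v_{n+1}. If the initializations satisfy q̃_0 = q_0 and v_0 = −p_0/h, then for all n ≥ 0 one has q̃_n = q_n and v_n = −p_n/h; that is, the two iterations generate identical parameter trajectories. -/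
/-- The OBA discretization of underdamped Langevin dynamics at `τ = 0`,
`p_{n+1} = e^{−γh} p_n − h ∇V(q_n)`, `q_{n+1} = q_n + h p_{n+1}`, coincides with the PyTorch
form of SGD with momentum `μ = e^{−γh}` and stepsize `δt = h²`,
`v_{n+1} = μ v_n + ∇V(q̃_n)`, `q̃_{n+1} = q̃_n − δt v_{n+1}`, provided `q̃_0 = q_0` and
`v_0 = −p_0/h`: then `q̃_n = q_n` and `v_n = −p_n/h` for all `n`. -/
theorem stmt_12 {n : ℕ} (V : (Fin n → ℝ) → ℝ) (hV : Differentiable ℝ V)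
    (gradV : (Fin n → ℝ) → Fin n → ℝ)
    (hgrad : ∀ x i, gradV x i = fderiv ℝ V x (Pi.single i 1))
    (h γ : ℝ) (hh : 0 < h) (hγ : 0 ≤ γ)
    (μ δt : ℝ) (hμ : μ = Real.exp (-γ * h)) (hδt : δt = h ^ 2)
    (p q v qt : ℕ → Fin n → ℝ)
    (hp : ∀ k, p (k + 1) = Real.exp (-γ * h) • p k - h • gradV (q k))
    (hq : ∀ k, q (k + 1) = q k + h • p (k + 1))
    (hv : ∀ k, v (k + 1) = μ • v k + gradV (qt k))
    (hqt : ∀ k, qt (k + 1) = qt k - δt • v (k + 1))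
    (h0 : qt 0 = q 0) (hv0 : v 0 = -(1 / h) • p 0) :
    ∀ k, qt k = q k ∧ v k = -(1 / h) • p k := by
  subst hμ hδt
  have hne : h ≠ 0 := hh.ne'
  intro k
  induction k with
  | zero => exact ⟨h0, hv0⟩
  | succ k ih =>
    obtain ⟨ihq, ihv⟩ := ih
    have hv' : v (k + 1) = -(1 / h) • p (k + 1) := by
      rw [hv, hp, ihq, ihv]
      ext i
      simp only [Pi.add_apply, Pi.sub_apply, Pi.smul_apply, smul_eq_mul]
      field_simp
      ring
    refine ⟨?_, hv'⟩
    rw [hqt, hq, ihq, hv']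
    ext i
    simp only [Pi.add_apply, Pi.sub_apply, Pi.smul_apply, smul_eq_mul]
    field_simp
    ring
end
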